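/- arXiv:2401.05330 — 6 statements merged into one kernel-verified Lean document; each statement's English description precedes it below -/
import Mathlib

section
/- Let X and Y be measurable spaces, let ν be a probability measure on Y, let μ be a probability measure on X, and let κ be a Markov kernel from X to Y. Then KL(ν ‖ μ.bind κ) ≤ ∫ KL(ν ‖ κ(x)) dμ(x), as an inequality of extended nonnegative reals. -/
open MeasureTheory ProbabilityTheory
open scoped ENNReal Classical

/-- The Kullback–Leibler divergence `KL(μ ‖ ν)`: it equals `∫ log (dμ/dν) dμ` when `μ ≪ ν` and
this log-density is integrable, and `+∞` otherwise. -/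
noncomputable def klDiv {α : Type*} [MeasurableSpace α] (μ ν : Measure α) : ℝ≥0∞ :=
  if μ ≪ ν ∧ Integrable (fun x => Real.log (μ.rnDeriv ν x).toReal) μ then
    ENNReal.ofReal (∫ x, Real.log (μ.rnDeriv ν x).toReal ∂μ)
  else ⊤

lemma klDiv_eq_infoKL {Y : Type*} [MeasurableSpace Y] (ν m : Measure Y)
    [IsProbabilityMeasure ν] [IsProbabilityMeasure m] :
    klDiv ν m = InformationTheory.klDiv ν m := by
  have h : (fun x => Real.log (ν.rnDeriv m x).toReal) = llr ν m := rfl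
  unfold klDiv
  rw [h]
  split_ifs with hc
  · rw [InformationTheory.klDiv_of_ac_of_integrable hc.1 hc.2]
    simp
  · symm
    rw [InformationTheory.klDiv_eq_top_iff]
    tauto

lemma young_klFun (t g : ℝ) (ht : 0 ≤ t) :
    t * g + 1 - Real.exp g ≤ InformationTheory.klFun t := by
  unfold InformationTheory.klFun
  rcases ht.eq_or_lt with rfl | ht
  · have := Real.exp_pos g
    simp
    linarith
  · have h := Real.add_one_le_exp (g - Real.log t)
    rw [Real.exp_sub, Real.exp_log ht, le_div_iff₀ ht] at h
    nlinarith

lemma integrable_of_bdd {Y : Type*} [MeasurableSpace Y] (m : Measure Y)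
    [IsProbabilityMeasure m] (g : Y → ℝ) (hg : Measurable g) (C : ℝ) (hC : ∀ y, |g y| ≤ C) :
    Integrable g m :=
  Integrable.of_bound hg.aestronglyMeasurable C (Filter.Eventually.of_forall hC)

lemma abs_exp_le_of_abs_le (a C : ℝ) (h : |a| ≤ C) : |Real.exp a| ≤ Real.exp C := by
  rw [abs_of_pos (Real.exp_pos a)]
  exact Real.exp_le_exp.2 ((le_abs_self a).trans h)

lemma integral_add_one_sub {Y : Type*} [MeasurableSpace Y] (m : Measure Y)
    [IsProbabilityMeasure m] (a b : Y → ℝ) (ha : Integrable a m) (hb : Integrable b m) :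
    ∫ y, (a y + 1 - b y) ∂m = ∫ y, a y ∂m + 1 - ∫ y, b y ∂m := by
  have h1 : Integrable (fun y => a y + 1) m := ha.add (integrable_const 1)
  rw [integral_sub h1 hb, integral_add ha (integrable_const 1)]
  simp

/-- Linearised Donsker–Varadhan lower bound. -/
lemma dv_le_klDiv {Y : Type*} [MeasurableSpace Y] (ν m : Measure Y)
    [IsProbabilityMeasure ν] [IsProbabilityMeasure m]
    (g : Y → ℝ) (hg : Measurable g) (C : ℝ) (hC : ∀ y, |g y| ≤ C) :
    ENNReal.ofReal (∫ y, g y ∂ν + 1 - ∫ y, Real.exp (g y) ∂m) ≤ klDiv ν m := by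
  rw [klDiv_eq_infoKL, InformationTheory.klDiv_eq_integral_klFun]
  split_ifs with h
  swap
  · exact le_top
  obtain ⟨hac, hint⟩ := h
  have hgν := integrable_of_bdd ν g hg C hC
  have hem : Integrable (fun y => Real.exp (g y)) m :=
    integrable_of_bdd m _ hg.exp (Real.exp C) fun y => abs_exp_le_of_abs_le _ _ (hC y)
  have hgm : Integrable (fun y => (ν.rnDeriv m y).toReal * g y) m := by
    simpa using (integrable_rnDeriv_smul_iff (f := g) hac).2 hgν
  have e1 : ∫ y, g y ∂ν = ∫ y, (ν.rnDeriv m y).toReal * g y ∂m := by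
    simpa using (integral_rnDeriv_smul (f := g) hac).symm
  have e2 : ∫ y, g y ∂ν + 1 - ∫ y, Real.exp (g y) ∂m
      = ∫ y, ((ν.rnDeriv m y).toReal * g y + 1 - Real.exp (g y)) ∂m := by
    rw [integral_add_one_sub _ _ _ hgm hem, e1]
  rw [e2]
  apply ENNReal.ofReal_le_ofReal
  apply integral_mono ((hgm.add (integrable_const 1)).sub hem)
    ((InformationTheory.integrable_klFun_rnDeriv_iff hac).2 hint)
  intro y
  exact young_klFun _ _ ENNReal.toReal_nonneg

/-- Truncation of `t` to the interval `[1/(n+1), n+1]`. -/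
noncomputable def klClamp (n : ℕ) (t : ℝ) : ℝ := max (1 / ((n : ℝ) + 1)) (min t ((n : ℝ) + 1))

lemma one_div_le_clamp (n : ℕ) (t : ℝ) : 1 / ((n : ℝ) + 1) ≤ klClamp n t := le_max_left _ _

lemma clamp_le (n : ℕ) (t : ℝ) : klClamp n t ≤ (n : ℝ) + 1 := by
  have hn : (1 : ℝ) ≤ (n : ℝ) + 1 := by linarith [n.cast_nonneg (α := ℝ)]
  refine max_le ?_ (min_le_right _ _)
  rw [div_le_iff₀ (by linarith)]
  nlinarith

lemma clamp_pos (n : ℕ) (t : ℝ) : 0 < klClamp n t :=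
  lt_of_lt_of_le (by positivity) (one_div_le_clamp n t)

lemma measurable_clamp (n : ℕ) : Measurable (klClamp n) := by
  unfold klClamp; fun_prop

lemma abs_log_clamp_le (n : ℕ) (t : ℝ) : |Real.log (klClamp n t)| ≤ Real.log ((n : ℝ) + 1) := by
  rw [abs_le]
  constructor
  · rw [← Real.log_inv, ← one_div]
    exact Real.log_le_log (by positivity) (one_div_le_clamp n t)
  · exact Real.log_le_log (clamp_pos n t) (clamp_le n t)

lemma clamp_integrand_nonneg (n : ℕ) (t : ℝ) :
    0 ≤ t * Real.log (klClamp n t) + 1 - klClamp n t := by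
  have h1 := InformationTheory.klFun_nonneg (clamp_pos n t).le
  unfold InformationTheory.klFun at h1
  suffices 0 ≤ (t - klClamp n t) * Real.log (klClamp n t) by nlinarith
  have hn : (1 : ℝ) ≤ (n : ℝ) + 1 := by linarith [n.cast_nonneg (α := ℝ)]
  have hn' : 1 / ((n : ℝ) + 1) ≤ 1 := by
    rw [div_le_iff₀ (by linarith)]; linarith
  rcases le_total t ((n : ℝ) + 1) with h | h
  · rcases le_total t (1 / ((n : ℝ) + 1)) with h' | h'
    · have : klClamp n t = 1 / ((n : ℝ) + 1) := by
        unfold klClamp; rw [min_eq_left h, max_eq_left h']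
      rw [this]
      exact mul_nonneg_of_nonpos_of_nonpos (by linarith)
        (Real.log_nonpos (by positivity) hn')
    · have : klClamp n t = t := by
        unfold klClamp; rw [min_eq_left h, max_eq_right h']
      rw [this]; simp
  · have : klClamp n t = (n : ℝ) + 1 := by
      unfold klClamp; rw [min_eq_right h, max_eq_right (hn'.trans hn)]
    rw [this]
    exact mul_nonneg (by linarith) (Real.log_nonneg hn)

lemma tendsto_clamp (t : ℝ) (ht : 0 ≤ t) :
    Filter.Tendsto (fun n : ℕ => klClamp n t) Filter.atTop (nhds t) := by
  have h1 : Filter.Tendsto (fun n : ℕ => max (1 / ((n : ℝ) + 1)) t) Filter.atTop (nhds (max 0 t)) :=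
    tendsto_one_div_add_atTop_nhds_zero_nat.max tendsto_const_nhds
  rw [max_eq_right ht] at h1
  refine h1.congr' ?_
  obtain ⟨N, hN⟩ := exists_nat_ge t
  filter_upwards [Filter.eventually_ge_atTop N] with n hn
  have : (N : ℝ) ≤ n := by exact_mod_cast hn
  unfold klClamp
  rw [min_eq_left (by linarith)]

lemma tendsto_clamp_integrand (t : ℝ) (ht : 0 ≤ t) :
    Filter.Tendsto (fun n : ℕ => t * Real.log (klClamp n t) + 1 - klClamp n t) Filter.atTop
      (nhds (InformationTheory.klFun t)) := by
  unfold InformationTheory.klFun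
  have hc := tendsto_clamp t ht
  rcases ht.eq_or_lt with rfl | ht'
  · simpa using hc.const_sub 1
  · exact (((hc.log ht'.ne').const_mul t).add_const 1).sub hc

lemma klDiv_le_of_forall_dv {Y : Type*} [MeasurableSpace Y] (ν m : Measure Y)
    [IsProbabilityMeasure ν] [IsProbabilityMeasure m] (B : ℝ≥0∞)
    (hB : ∀ g : Y → ℝ, Measurable g → ∀ C : ℝ, (∀ y, |g y| ≤ C) →
      ENNReal.ofReal (∫ y, g y ∂ν + 1 - ∫ y, Real.exp (g y) ∂m) ≤ B) :
    klDiv ν m ≤ B := by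
  by_cases hac : ν ≪ m
  · rw [klDiv_eq_infoKL, InformationTheory.klDiv_eq_lintegral_klFun_of_ac hac]
    set f : Y → ℝ := fun y => (ν.rnDeriv m y).toReal with hf
    have hfm : Measurable f := (Measure.measurable_rnDeriv ν m).ennreal_toReal
    have hf0 : ∀ y, 0 ≤ f y := fun y => ENNReal.toReal_nonneg
    let F : ℕ → Y → ℝ := fun n y =>
      f y * Real.log (klClamp n (f y)) + 1 - klClamp n (f y)
    have hclm : ∀ n, Measurable fun y => klClamp n (f y) := fun n => (measurable_clamp n).comp hfm
    have hFm : ∀ n, Measurable (F n) := fun n =>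
      ((hfm.mul (hclm n).log).add_const 1).sub (hclm n)
    have hlim : ∀ y, Filter.liminf (fun n => ENNReal.ofReal (F n y)) Filter.atTop
        = ENNReal.ofReal (InformationTheory.klFun (f y)) := fun y =>
      (ENNReal.tendsto_ofReal (tendsto_clamp_integrand (f y) (hf0 y))).liminf_eq
    have hbd : ∀ n, ∫⁻ y, ENNReal.ofReal (F n y) ∂m ≤ B := by
      intro n
      let g : Y → ℝ := fun y => Real.log (klClamp n (f y))
      have hg : Measurable g := (hclm n).log
      have hgb : ∀ y, |g y| ≤ Real.log ((n : ℝ) + 1) := fun y => abs_log_clamp_le n (f y)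
      have hexp : ∀ y, Real.exp (g y) = klClamp n (f y) := fun y => Real.exp_log (clamp_pos n _)
      have hgν := integrable_of_bdd ν g hg _ hgb
      have hem : Integrable (fun y => klClamp n (f y)) m :=
        integrable_of_bdd m _ (hclm n) ((n : ℝ) + 1) fun y => by
          rw [abs_of_pos (clamp_pos n _)]; exact clamp_le n _
      have hgm : Integrable (fun y => f y * g y) m := by
        simpa using (integrable_rnDeriv_smul_iff (f := g) hac).2 hgν
      have e1 : ∫ y, g y ∂ν = ∫ y, f y * g y ∂m := by
        simpa using (integral_rnDeriv_smul (f := g) hac).symm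
      have e2 : ∫ y, g y ∂ν + 1 - ∫ y, Real.exp (g y) ∂m = ∫ y, F n y ∂m := by
        simp only [hexp]
        change _ = ∫ y, (f y * g y + 1 - klClamp n (f y)) ∂m
        rw [integral_add_one_sub _ _ _ hgm hem, e1]
      have hFi : Integrable (F n) m := (hgm.add (integrable_const 1)).sub hem
      have := hB g hg _ hgb
      rw [e2, ofReal_integral_eq_lintegral_ofReal hFi
        (Filter.Eventually.of_forall fun y => clamp_integrand_nonneg n (f y))] at this
      exact this
    calc ∫⁻ y, ENNReal.ofReal (InformationTheory.klFun (f y)) ∂m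
        = ∫⁻ y, Filter.liminf (fun n => ENNReal.ofReal (F n y)) Filter.atTop ∂m := by
          simp only [hlim]
      _ ≤ Filter.liminf (fun n => ∫⁻ y, ENNReal.ofReal (F n y) ∂m) Filter.atTop :=
          lintegral_liminf_le fun n => (hFm n).ennreal_ofReal
      _ ≤ Filter.liminf (fun _ : ℕ => B) Filter.atTop :=
          Filter.liminf_le_liminf (Filter.Eventually.of_forall hbd)
      _ = B := Filter.liminf_const B
  · suffices B = ⊤ by rw [this]; exact le_top
    obtain ⟨A, hA, hmA, hνA⟩ : ∃ A, MeasurableSet A ∧ m A = 0 ∧ ν A ≠ 0 := by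
      by_contra! hcon
      exact hac (Measure.AbsolutelyContinuous.mk hcon)
    have hpos : 0 < ν.real A := by
      rw [measureReal_def]; exact ENNReal.toReal_pos hνA (measure_ne_top _ _)
    have key : ∀ n : ℕ, ENNReal.ofReal ((n : ℝ) * ν.real A) ≤ B := by
      intro n
      have h := hB (A.indicator fun _ => (n : ℝ)) (measurable_const.indicator hA) n (by
        intro y
        by_cases hy : y ∈ A <;> simp [hy])
      have e1 : ∫ y, A.indicator (fun _ => (n : ℝ)) y ∂ν = (n : ℝ) * ν.real A := by
        rw [integral_indicator_const _ hA]; simp [mul_comm]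
      have e2 : ∫ y, Real.exp (A.indicator (fun _ => (n : ℝ)) y) ∂m = 1 := by
        have : (fun y => Real.exp (A.indicator (fun _ => (n : ℝ)) y)) =ᵐ[m] fun _ => (1 : ℝ) := by
          have hAe : ∀ᵐ y ∂m, y ∉ A := measure_eq_zero_iff_ae_notMem.1 hmA
          filter_upwards [hAe] with y hy
          simp [hy]
        rw [integral_congr_ae this]; simp
      rw [e1, e2] at h
      simpa using h
    refine ENNReal.eq_top_of_forall_nnreal_le fun r => ?_
    obtain ⟨n, hn⟩ := exists_nat_ge ((r : ℝ) / ν.real A)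
    refine le_trans ?_ (key n)
    rw [← ENNReal.ofReal_coe_nnreal]
    exact ENNReal.ofReal_le_ofReal ((div_le_iff₀ hpos).1 hn)

lemma ofReal_integral_le_lint {X : Type*} [MeasurableSpace X] (μ : Measure X)
    (φ : X → ℝ) (hφ : Integrable φ μ) :
    ENNReal.ofReal (∫ x, φ x ∂μ) ≤ ∫⁻ x, ENNReal.ofReal (φ x) ∂μ := by
  calc ENNReal.ofReal (∫ x, φ x ∂μ) ≤ ENNReal.ofReal (∫ x, max (φ x) 0 ∂μ) :=
        ENNReal.ofReal_le_ofReal (integral_mono hφ hφ.pos_part fun x => le_max_left _ _)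
    _ = ∫⁻ x, ENNReal.ofReal (max (φ x) 0) ∂μ :=
        ofReal_integral_eq_lintegral_ofReal hφ.pos_part
          (Filter.Eventually.of_forall fun x => le_max_right _ _)
    _ = ∫⁻ x, ENNReal.ofReal (φ x) ∂μ := by simp

/-- For probability measures `ν` on `Y` and `μ` on `X` and a Markov kernel `κ` from `X` to `Y`,
the KL divergence from `ν` to the mixture `μ.bind κ` is at most the average KL divergence
from `ν` to the components `κ x`. -/
theorem klDiv_bind_le_lintegral_klDiv
    {X Y : Type*} [MeasurableSpace X] [MeasurableSpace Y]
    (ν : Measure Y) [IsProbabilityMeasure ν]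
    (μ : Measure X) [IsProbabilityMeasure μ]
    (κ : Kernel X Y) [IsMarkovKernel κ] :
    klDiv ν (μ.bind fun x => κ x) ≤ ∫⁻ x, klDiv ν (κ x) ∂μ := by
  have : IsProbabilityMeasure (μ.bind fun x => κ x) :=
    inferInstanceAs (IsProbabilityMeasure (κ ∘ₘ μ))
  refine klDiv_le_of_forall_dv _ _ _ fun g hg C hC => ?_
  have hb : ∀ y, |Real.exp (g y)| ≤ Real.exp C := fun y => abs_exp_le_of_abs_le _ _ (hC y)
  have hem : Integrable (fun y => Real.exp (g y)) (κ ∘ₘ μ) :=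
    integrable_of_bdd _ _ hg.exp (Real.exp C) hb
  have hei : Integrable (fun x => ∫ y, Real.exp (g y) ∂(κ x)) μ := by
    have := ((Measure.integrable_comp_iff hem.aestronglyMeasurable).1 hem).2
    simpa using this
  have e : ∫ y, Real.exp (g y) ∂(μ.bind fun x => κ x) = ∫ x, ∫ y, Real.exp (g y) ∂(κ x) ∂μ := by
    have hk : (κ ∘ₖ Kernel.const Unit μ) () = κ ∘ₘ μ := by
      rw [Kernel.comp_apply, Kernel.const_apply]
    have h := Kernel.integral_comp (η := κ) (κ := Kernel.const Unit μ) (a := ())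
      (f := fun y => Real.exp (g y)) (by rw [hk]; exact hem)
    rw [hk, Kernel.const_apply] at h
    exact h
  have e2 : ∫ y, g y ∂ν + 1 - ∫ y, Real.exp (g y) ∂(μ.bind fun x => κ x)
      = ∫ x, (∫ y, g y ∂ν + 1 - ∫ y, Real.exp (g y) ∂(κ x)) ∂μ := by
    rw [integral_sub (integrable_const _) hei, e]
    simp
  rw [e2]
  refine (ofReal_integral_le_lint μ _ ((integrable_const _).sub hei)).trans ?_
  exact lintegral_mono fun x => dv_le_klDiv ν (κ x) g hg C hC
end

section
/- With the exponential-family setup, suppose η₀ lies in the domain D, η₁ ∈ D, and the log-partition function κ is differentiable at η₀ with gradient ∇κ(η₀). Then KL(P_{η₀} ‖ P_{η₁}) = κ(η₁) − κ(η₀) − ⟪∇κ(η₀), η₁ − η₀⟫; that is, the Kullback–Leibler divergence between two members of an exponential family equals the Bregman divergence of the log-partition function evaluated at their natural parameters. -/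
open MeasureTheory ProbabilityTheory
open scoped ENNReal NNReal Classical RealInnerProductSpace

/-- The log-partition function `κ(η) = log ∫ exp ⟪η, s ω⟫ dμ₀(ω)` of the exponential family with
base measure `μ₀` and sufficient statistic `s`. -/
noncomputable def logPartition {Ω : Type*} [MeasurableSpace Ω] (μ₀ : Measure Ω) {K : ℕ}
    (s : Ω → EuclideanSpace ℝ (Fin K)) (η : EuclideanSpace ℝ (Fin K)) : ℝ :=
  Real.log (∫⁻ ω, ENNReal.ofReal (Real.exp ⟪η, s ω⟫) ∂μ₀).toReal

/-- The natural domain `D = {η : κ(η) < ∞}` of the log-partition function, i.e. the set of `η`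
where the integral `∫ exp ⟪η, s ω⟫ dμ₀(ω)` is finite. -/
def expFamilyDomain {Ω : Type*} [MeasurableSpace Ω] (μ₀ : Measure Ω) {K : ℕ}
    (s : Ω → EuclideanSpace ℝ (Fin K)) : Set (EuclideanSpace ℝ (Fin K)) :=
  {η | ∫⁻ ω, ENNReal.ofReal (Real.exp ⟪η, s ω⟫) ∂μ₀ < ⊤}

/-- The member `P_η` of the exponential family with base measure `μ₀` and sufficient statistic
`s`, i.e. the measure with density `ω ↦ exp (⟪η, s ω⟫ - κ(η))` with respect to `μ₀`. -/
noncomputable def expFamilyMeasure {Ω : Type*} [MeasurableSpace Ω] (μ₀ : Measure Ω) {K : ℕ}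
    (s : Ω → EuclideanSpace ℝ (Fin K)) (η : EuclideanSpace ℝ (Fin K)) : Measure Ω :=
  μ₀.withDensity fun ω => ENNReal.ofReal (Real.exp (⟪η, s ω⟫ - logPartition μ₀ s η))

open Filter Topology in
lemma aux_tendsto_slope (x : ℝ) :
    Tendsto (fun t : ℝ => (Real.exp (t * x) - 1) / t) (𝓝[>] 0) (𝓝 x) := by
  have h : HasDerivAt (fun t : ℝ => Real.exp (t * x)) x 0 := by
    simpa using ((hasDerivAt_id (0 : ℝ)).mul_const x).exp
  have h2 := (hasDerivAt_iff_tendsto_slope.1 h).mono_left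
    (nhdsWithin_mono (0 : ℝ) (fun t (ht : 0 < t) => ne_of_gt ht))
  refine h2.congr fun t => ?_
  simp [slope_def_field]

lemma aux_slope_le (x t : ℝ) (ht : 0 < t) (ht1 : t ≤ 1) :
    (Real.exp (t * x) - 1) / t ≤ Real.exp x - 1 := by
  have := convexOn_exp.2 (Set.mem_univ (0 : ℝ)) (Set.mem_univ x) (sub_nonneg.2 ht1) ht.le
    (by ring)
  simp only [smul_eq_mul, mul_zero, zero_add, Real.exp_zero, mul_one] at this
  rw [div_le_iff₀ ht]
  linarith

lemma aux_le_slope (x t : ℝ) (ht : 0 < t) :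
    x ≤ (Real.exp (t * x) - 1) / t := by
  rw [le_div_iff₀ ht]
  linarith [Real.add_one_le_exp (t * x)]

open Filter Topology in
lemma aux_integral {Ω : Type*} [MeasurableSpace Ω] (P : Measure Ω) [IsFiniteMeasure P]
    (X : Ω → ℝ) (hX : Measurable X) (hexp : Integrable (fun ω => Real.exp (X ω)) P) (L : ℝ)
    (hL : Tendsto (fun t : ℝ => ∫ ω, (Real.exp (t * X ω) - 1) / t ∂P) (𝓝[>] 0) (𝓝 L)) :
    Integrable X P ∧ ∫ ω, X ω ∂P = L := by
  have hI1 : Integrable (fun ω => Real.exp (X ω) - 1) P := hexp.sub (integrable_const _)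
  have hev : ∀ᶠ t : ℝ in 𝓝[>] 0, 0 < t ∧ t ≤ 1 := by
    filter_upwards [Ioc_mem_nhdsGT (zero_lt_one' ℝ)] with t ht using ht
  have hIt : ∀ t : ℝ, 0 < t → t ≤ 1 → Integrable (fun ω => (Real.exp (t * X ω) - 1) / t) P := by
    intro t h0 h1
    exact ((integrable_exp_mul_of_nonneg_of_le (u := 1) (by simpa using hexp) h0.le h1).sub
      (integrable_const _)).div_const _
  have hfatou := lintegral_liminf_le (μ := P) (u := 𝓝[>] (0 : ℝ))
    (f := fun t ω => ENNReal.ofReal ((Real.exp (X ω) - 1) - (Real.exp (t * X ω) - 1) / t))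
    (fun t => by fun_prop)
  have hl1 : ∀ ω, liminf (fun t : ℝ => ENNReal.ofReal
      ((Real.exp (X ω) - 1) - (Real.exp (t * X ω) - 1) / t)) (𝓝[>] 0)
      = ENNReal.ofReal ((Real.exp (X ω) - 1) - X ω) := fun ω =>
    (ENNReal.tendsto_ofReal ((aux_tendsto_slope (X ω)).const_sub _)).liminf_eq
  have hl2 : liminf (fun t : ℝ => ∫⁻ ω, ENNReal.ofReal
      ((Real.exp (X ω) - 1) - (Real.exp (t * X ω) - 1) / t) ∂P) (𝓝[>] 0)
      = ENNReal.ofReal ((∫ ω, (Real.exp (X ω) - 1) ∂P) - L) := by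
    refine Tendsto.liminf_eq ?_
    refine (ENNReal.tendsto_ofReal (hL.const_sub _)).congr' ?_
    filter_upwards [hev] with t ht
    rw [← integral_sub hI1 (hIt t ht.1 ht.2)]
    exact ofReal_integral_eq_lintegral_ofReal (hI1.sub (hIt t ht.1 ht.2))
      (ae_of_all _ fun ω => sub_nonneg.2 (aux_slope_le _ _ ht.1 ht.2))
  simp only [hl1] at hfatou
  rw [hl2] at hfatou
  have hint : Integrable (fun ω => (Real.exp (X ω) - 1) - X ω) P := by
    refine ⟨by fun_prop, ?_⟩
    rw [hasFiniteIntegral_iff_ofReal]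
    · exact hfatou.trans_lt ENNReal.ofReal_lt_top
    · refine ae_of_all _ fun ω => ?_
      have := Real.add_one_le_exp (X ω)
      simp only [Pi.zero_apply]
      linarith
  have hXi : Integrable X P := by
    refine (hI1.sub hint).congr (ae_of_all _ fun ω => ?_)
    simp
  refine ⟨hXi, ?_⟩
  refine tendsto_nhds_unique ?_ hL
  refine tendsto_integral_filter_of_dominated_convergence
    (fun ω => |X ω| + |Real.exp (X ω) - 1|) (Eventually.of_forall fun t => by fun_prop) ?_
    (hXi.abs.add hI1.abs) (ae_of_all _ fun ω => aux_tendsto_slope _)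
  filter_upwards [hev] with t ht
  refine ae_of_all _ fun ω => ?_
  have h1 := aux_slope_le (X ω) t ht.1 ht.2
  have h2 := aux_le_slope (X ω) t ht.1
  rw [Real.norm_eq_abs, abs_le]
  constructor
  · linarith [neg_abs_le (X ω), abs_nonneg (Real.exp (X ω) - 1)]
  · linarith [le_abs_self (Real.exp (X ω) - 1), abs_nonneg (X ω)]

section
variable {Ω : Type*} [MeasurableSpace Ω] (μ₀ : Measure Ω) {K : ℕ}
    (s : Ω → EuclideanSpace ℝ (Fin K)) (hs : Measurable s)

lemma aux_meas (hs : Measurable s) (η : EuclideanSpace ℝ (Fin K)) :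
    Measurable fun ω => ⟪η, s ω⟫ := by fun_prop

lemma aux_int (hs : Measurable s) (η : EuclideanSpace ℝ (Fin K))
    (h : η ∈ expFamilyDomain μ₀ s) : Integrable (fun ω => Real.exp ⟪η, s ω⟫) μ₀ := by
  have := aux_meas s hs η
  refine ⟨by fun_prop, ?_⟩
  rw [hasFiniteIntegral_iff_ofReal (ae_of_all _ fun ω => (Real.exp_pos _).le)]
  exact h

lemma aux_kappa (hs : Measurable s) (η : EuclideanSpace ℝ (Fin K)) :
    logPartition μ₀ s η = Real.log (∫ ω, Real.exp ⟪η, s ω⟫ ∂μ₀) := by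
  have := aux_meas s hs η
  rw [logPartition, integral_eq_lintegral_of_nonneg_ae
    (ae_of_all _ fun ω => (Real.exp_pos _).le) (by fun_prop)]

lemma aux_tilted [NeZero μ₀] (hs : Measurable s) (η : EuclideanSpace ℝ (Fin K))
    (h : η ∈ expFamilyDomain μ₀ s) :
    expFamilyMeasure μ₀ s η = μ₀.tilted (fun ω => ⟪η, s ω⟫) := by
  rw [expFamilyMeasure, Measure.tilted]
  congr 1
  ext ω
  rw [Real.exp_sub, aux_kappa μ₀ s hs, Real.exp_log (integral_exp_pos (aux_int μ₀ s hs η h))]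

end

/-- The KL divergence between two members of an exponential family is the Bregman divergence of
the log-partition function `κ` evaluated at their natural parameters:
`KL(P_{η₀} ‖ P_{η₁}) = κ(η₁) − κ(η₀) − ⟪∇κ(η₀), η₁ − η₀⟫`, provided `η₀, η₁` lie in the domain
and `κ` has gradient `∇κ(η₀)` at `η₀`. -/
theorem klDiv_expFamilyMeasure_eq_bregman
    {Ω : Type*} [MeasurableSpace Ω] (μ₀ : Measure Ω) [SigmaFinite μ₀] {K : ℕ}
    (s : Ω → EuclideanSpace ℝ (Fin K)) (hs : Measurable s)
    (η₀ η₁ : EuclideanSpace ℝ (Fin K))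
    (hη₀ : η₀ ∈ expFamilyDomain μ₀ s) (hη₁ : η₁ ∈ expFamilyDomain μ₀ s)
    (gradκ : EuclideanSpace ℝ (Fin K))
    (hgrad : HasGradientAt (logPartition μ₀ s) gradκ η₀) :
    klDiv (expFamilyMeasure μ₀ s η₀) (expFamilyMeasure μ₀ s η₁)
      = ENNReal.ofReal
          (logPartition μ₀ s η₁ - logPartition μ₀ s η₀ - ⟪gradκ, η₁ - η₀⟫) := by
  rcases eq_zero_or_neZero μ₀ with h0 | h0
  · subst h0
    have hz : logPartition (0 : Measure Ω) s = fun _ => 0 := by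
      ext η; simp [logPartition]
    have hg : gradκ = 0 := by
      rw [hz] at hgrad
      exact hgrad.unique (hasGradientAt_const η₀ (0 : ℝ))
    simp [klDiv, expFamilyMeasure, hz, hg, Measure.AbsolutelyContinuous.rfl]
  set X : Ω → ℝ := fun ω => ⟪η₁ - η₀, s ω⟫ with hXdef
  have hX : Measurable X := aux_meas s hs _
  have hi0 := aux_int μ₀ s hs η₀ hη₀
  have hi1 := aux_int μ₀ s hs η₁ hη₁
  have hadd : ∀ t : ℝ, ((fun ω => ⟪η₀, s ω⟫) + fun ω => t * X ω)
      = fun ω => ⟪η₀ + t • (η₁ - η₀), s ω⟫ := by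
    intro t; ext ω
    simp only [hXdef, Pi.add_apply, inner_add_left, real_inner_smul_left]
  have hadd1 : ((fun ω => ⟪η₀, s ω⟫) + X) = fun ω => ⟪η₁, s ω⟫ := by
    have := hadd 1
    simpa using this
  rw [aux_tilted μ₀ s hs η₀ hη₀, aux_tilted μ₀ s hs η₁ hη₁, ← hadd1, ← tilted_tilted hi0]
  have hPp : IsProbabilityMeasure (μ₀.tilted fun ω => ⟪η₀, s ω⟫) :=
    isProbabilityMeasure_tilted hi0
  have hZ : ∀ t : ℝ, ∫ ω, Real.exp (t * X ω) ∂(μ₀.tilted fun ω => ⟪η₀, s ω⟫)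
      = (∫ ω, Real.exp ⟪η₀ + t • (η₁ - η₀), s ω⟫ ∂μ₀) / ∫ ω, Real.exp ⟪η₀, s ω⟫ ∂μ₀ := by
    intro t
    rw [integral_exp_tilted, hadd t]
  have hXexp : Integrable (fun ω => Real.exp (X ω)) (μ₀.tilted fun ω => ⟪η₀, s ω⟫) := by
    rw [integrable_tilted_iff hi0]
    refine hi1.congr (ae_of_all _ fun ω => ?_)
    have := congrFun hadd1 ω
    simp only [Pi.add_apply] at this
    simp only [smul_eq_mul, ← Real.exp_add, this]
  have hpos0 := integral_exp_pos hi0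
  generalize hP : (μ₀.tilted fun ω => ⟪η₀, s ω⟫) = P at *
  have hIexp : ∀ t : ℝ, 0 < t → t ≤ 1 → Integrable (fun ω => Real.exp (t * X ω)) P :=
    fun t h0 h1 => integrable_exp_mul_of_nonneg_of_le (u := 1) (by simpa using hXexp) h0.le h1
  have hZk : ∀ t : ℝ, 0 < t → t ≤ 1 → ∫ ω, Real.exp (t * X ω) ∂P
      = Real.exp (logPartition μ₀ s (η₀ + t • (η₁ - η₀)) - logPartition μ₀ s η₀) := by
    intro t ht ht1
    have hp := integral_exp_pos (hIexp t ht ht1)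
    have hp2 : 0 < ∫ ω, Real.exp ⟪η₀ + t • (η₁ - η₀), s ω⟫ ∂μ₀ := by
      rw [hZ t] at hp
      exact (div_pos_iff_of_pos_right hpos0).1 hp
    rw [hZ t, aux_kappa μ₀ s hs, aux_kappa μ₀ s hs, Real.exp_sub, Real.exp_log hp2,
      Real.exp_log hpos0]
  have hder : HasDerivAt (fun t : ℝ =>
      Real.exp (logPartition μ₀ s (η₀ + t • (η₁ - η₀)) - logPartition μ₀ s η₀))
      ⟪gradκ, η₁ - η₀⟫ 0 := by
    have h1 : HasDerivAt (fun t : ℝ => η₀ + t • (η₁ - η₀)) (η₁ - η₀) 0 := by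
      simpa using ((hasDerivAt_id (0 : ℝ)).smul_const (η₁ - η₀)).const_add η₀
    have h2 : HasFDerivAt (logPartition μ₀ s)
        (InnerProductSpace.toDual ℝ (EuclideanSpace ℝ (Fin K)) gradκ)
        (η₀ + (0 : ℝ) • (η₁ - η₀)) := by
      simpa using hgrad.hasFDerivAt
    have h3 := ((h2.comp_hasDerivAt (0 : ℝ) h1).sub_const (logPartition μ₀ s η₀)).exp
    simpa using h3
  have hL : Filter.Tendsto (fun t : ℝ => ∫ ω, (Real.exp (t * X ω) - 1) / t ∂P)
      (nhdsWithin 0 (Set.Ioi 0)) (nhds ⟪gradκ, η₁ - η₀⟫) := by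
    have h2 := (hasDerivAt_iff_tendsto_slope.1 hder).mono_left
      (nhdsWithin_mono (0 : ℝ) (fun t (ht : 0 < t) => ne_of_gt ht))
    refine h2.congr' ?_
    filter_upwards [Ioc_mem_nhdsGT (zero_lt_one' ℝ)] with t ht
    rw [integral_div, integral_sub (hIexp t ht.1 ht.2) (integrable_const _), hZk t ht.1 ht.2]
    simp [slope_def_field]
  obtain ⟨hXi, hXeq⟩ := aux_integral P X hX hXexp _ hL
  have hllr : llr P P =ᵐ[P] fun _ => 0 := llr_self P
  have hllri : Integrable (llr P P) P := (integrable_congr hllr).2 (integrable_const 0)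
  have hk1 := hZk 1 one_pos le_rfl
  simp only [one_mul, one_smul, add_sub_cancel] at hk1
  have hac : P ≪ P.tilted X := absolutelyContinuous_tilted hXexp
  have hint := integrable_llr_tilted_right Measure.AbsolutelyContinuous.rfl hXi hllri hXexp
  have hval := integral_llr_tilted_right Measure.AbsolutelyContinuous.rfl hXi hXexp hllri
  rw [integral_congr_ae hllr, hXeq, hk1, Real.log_exp] at hval
  rw [klDiv, if_pos ⟨hac, hint⟩]
  congr 1
  refine hval.trans ?_
  simp only [integral_zero]
  ring
end

section
/- Let 𝒰, 𝒜, ℬ, 𝒞 be standard Borel spaces, μ a probability measure on 𝒰, and κ_A : 𝒰 → 𝒜, κ_B : 𝒰 → ℬ Markov kernels. Define the observational joint law of (U, A, B) by U ~ μ with A and B conditionally independent given U, A | U = u ~ κ_A(u) and B | U = u ~ κ_B(u). Let m : 𝒜 × ℬ → 𝒞 be measurable and fix a⋆ ∈ 𝒜. Define the post-intervention joint law by replacing κ_A with the constant kernel u ↦ δ_{a⋆}, leaving μ and κ_B unchanged. Then the post-intervention law of m(A, B) equals the pushforward, under b ↦ m(a⋆, b), of the observational marginal law of B. -/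
open MeasureTheory ProbabilityTheory

theorem bind_prod_map_apply_aux {𝒰 𝒜 ℬ : Type*}
    [MeasurableSpace 𝒰] [MeasurableSpace 𝒜] [MeasurableSpace ℬ]
    (μ : Measure 𝒰) [IsProbabilityMeasure μ]
    (κA : Kernel 𝒰 𝒜) [IsMarkovKernel κA]
    (κB : Kernel 𝒰 ℬ) [IsMarkovKernel κB] :
    (μ.bind fun u => ((κA u).prod (κB u)).map fun ab => (u, ab)) = μ ⊗ₘ (κA ×ₖ κB) := by
  have hk : (fun u => ((κA u).prod (κB u)).map fun ab => (u, ab))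
      = (Kernel.id ×ₖ (κA ×ₖ κB) : Kernel 𝒰 (𝒰 × 𝒜 × ℬ)) := by
    funext u
    rw [Kernel.prod_apply, Kernel.prod_apply, Kernel.id_apply, Measure.dirac_prod]
  rw [hk, Measure.compProd_eq_comp_prod]

/-- Identification in the collapsed `confounder` model: with hidden confounder `U ~ μ` and
`A`, `B` conditionally independent given `U` with conditional laws `κA` and `κB`, if we
intervene by replacing `κA` with the constant kernel `δ_{a⋆}`, then the post-intervention law
of `m(A, B)` equals the pushforward under `b ↦ m(a⋆, b)` of the observational marginal law
of `B`. -/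
theorem postIntervention_law_eq_map_observational_marginal
    {𝒰 𝒜 ℬ 𝒞 : Type*}
    [MeasurableSpace 𝒰] [StandardBorelSpace 𝒰]
    [MeasurableSpace 𝒜] [StandardBorelSpace 𝒜]
    [MeasurableSpace ℬ] [StandardBorelSpace ℬ]
    [MeasurableSpace 𝒞] [StandardBorelSpace 𝒞]
    (μ : Measure 𝒰) [IsProbabilityMeasure μ]
    (κA : Kernel 𝒰 𝒜) [IsMarkovKernel κA]
    (κB : Kernel 𝒰 ℬ) [IsMarkovKernel κB]
    (m : 𝒜 × ℬ → 𝒞) (hm : Measurable m) (astar : 𝒜)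
    (P Pstar : Measure (𝒰 × 𝒜 × ℬ))
    (hP : P = μ.bind fun u => ((κA u).prod (κB u)).map fun ab => (u, ab))
    (hPstar : Pstar = μ.bind fun u => ((Measure.dirac astar).prod (κB u)).map fun ab => (u, ab)) :
    Pstar.map (fun v => m v.2) = (P.map fun v => v.2.2).map fun b => m (astar, b) := by
  have h2 : Pstar = μ ⊗ₘ (Kernel.const 𝒰 (Measure.dirac astar) ×ₖ κB) := by
    rw [hPstar, ← bind_prod_map_apply_aux]
    simp only [Kernel.const_apply]
  rw [bind_prod_map_apply_aux] at hP
  have hma : Measurable fun b => m (astar, b) := by fun_prop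
  subst hP h2
  rw [Measure.map_map hma (by fun_prop)]
  ext s hs
  rw [Measure.map_apply (by fun_prop) hs, Measure.map_apply (by fun_prop) hs,
    Measure.compProd_apply (hs.preimage (by fun_prop)),
    Measure.compProd_apply (hs.preimage (by fun_prop))]
  refine lintegral_congr fun u => ?_
  rw [Kernel.prod_apply, Kernel.prod_apply, Kernel.const_apply, Measure.dirac_prod,
    show Prod.mk u ⁻¹' ((fun v : 𝒰 × 𝒜 × ℬ => m v.2) ⁻¹' s) = m ⁻¹' s from rfl,
    Measure.map_apply (by fun_prop) (hm hs)]
  have : (Prod.mk u ⁻¹' (((fun b => m (astar, b)) ∘ fun v : 𝒰 × 𝒜 × ℬ => v.2.2) ⁻¹' s))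
      = Set.univ ×ˢ ((fun b => m (astar, b)) ⁻¹' s) := by
    ext x; simp
  rw [this, Measure.prod_prod, measure_univ, one_mul]
  rfl
end

section
/- Let 𝒰, 𝒜, 𝒵, 𝒲 be standard Borel spaces, μ a probability measure on 𝒰, and κ_A : 𝒰 → 𝒜, κ_Z : 𝒜 → 𝒵, κ_W : 𝒵 × 𝒰 → 𝒲 Markov kernels. Define the observational joint law P of (U, A, Z, W) by U ~ μ, A | U = u ~ κ_A(u), Z | (U, A) = (u, a) ~ κ_Z(a) (Z depends only on A), and W | (U, A, Z) = (u, a, z) ~ κ_W(z, u) (W depends only on Z and U). Fix a⋆ ∈ 𝒜, and define the post-intervention law P_⋆ by replacing κ_A with the constant kernel u ↦ δ_{a⋆}. Let P_A and P_{(A,Z)} denote the observational laws of A and of (A, Z), and assume the positivity condition P_A ⊗ κ_Z(a⋆) ≪ P_{(A,Z)} (the product of P_A with the fixed measure κ_Z(a⋆) is absolutely continuous with respect to the observational joint law of (A,Z)). Then the post-intervention law of W is given by the front-door formula: for every measurable S ⊆ 𝒲, P_⋆(W ∈ S) = ∫_𝒵 ( ∫_𝒜 condDistrib(W | (A,Z))((a,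 z), S) dP_A(a) ) dκ_Z(a⋆)(z), where condDistrib(W | (A,Z)) is an observational regular conditional distribution of W given (A, Z). -/
open MeasureTheory ProbabilityTheory
open scoped ENNReal

lemma fd_meas_bind {α β γ : Type*} [MeasurableSpace α] [MeasurableSpace β] [MeasurableSpace γ]
    (κ : Kernel α β) [IsMarkovKernel κ] (F : α × β → Measure γ) (hF : Measurable F) :
    Measurable fun a => (κ a).bind fun b => F (a, b) := by
  refine Measure.measurable_of_measurable_coe _ fun s hs => ?_
  have h : ∀ a, ((κ a).bind fun b => F (a, b)) s = ∫⁻ b, F (a, b) s ∂(κ a) := fun a =>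
    Measure.bind_apply hs (hF.comp measurable_prodMk_left).aemeasurable
  simp_rw [h]
  exact Measurable.lintegral_kernel_prod_right'
    (f := fun p => F p s) ((Measure.measurable_coe hs).comp hF)

lemma fd_m1 {𝒰 𝒜 𝒵 𝒲 : Type*}
    [MeasurableSpace 𝒰] [MeasurableSpace 𝒜] [MeasurableSpace 𝒵] [MeasurableSpace 𝒲]
    (κW : Kernel (𝒵 × 𝒰) 𝒲) [IsMarkovKernel κW] :
    Measurable fun p : (𝒰 × 𝒜) × 𝒵 =>
      (κW (p.2, p.1.1)).map fun w => (p.1.1, p.1.2, p.2, w) := by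
  refine Measure.measurable_of_measurable_coe _ fun s hs => ?_
  have h : ∀ p : (𝒰 × 𝒜) × 𝒵, ((κW (p.2, p.1.1)).map fun w => (p.1.1, p.1.2, p.2, w)) s
      = (κW.comap (fun p : (𝒰 × 𝒜) × 𝒵 => (p.2, p.1.1)) (by fun_prop)) p
        (Prod.mk p ⁻¹' ((fun q : ((𝒰 × 𝒜) × 𝒵) × 𝒲 => (q.1.1.1, q.1.1.2, q.1.2, q.2)) ⁻¹' s)) :=
    fun p => by
      rw [Measure.map_apply (by fun_prop) hs]; rfl
  simp_rw [h]
  exact Kernel.measurable_kernel_prodMk_left (hs.preimage (by fun_prop))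

lemma fd_lintegral {𝒰 𝒜 𝒵 𝒲 : Type*}
    [MeasurableSpace 𝒰] [MeasurableSpace 𝒜] [MeasurableSpace 𝒵] [MeasurableSpace 𝒲]
    (μ : Measure 𝒰)
    (κA : Kernel 𝒰 𝒜) [IsMarkovKernel κA]
    (κZ : Kernel 𝒜 𝒵) [IsMarkovKernel κZ]
    (κW : Kernel (𝒵 × 𝒰) 𝒲) [IsMarkovKernel κW]
    (f : 𝒰 × 𝒜 × 𝒵 × 𝒲 → ℝ≥0∞) (hf : Measurable f) :
    ∫⁻ v, f v ∂(μ.bind fun u => (κA u).bind fun a => (κZ a).bind fun z =>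
      (κW (z, u)).map fun w => (u, a, z, w))
    = ∫⁻ u, ∫⁻ a, ∫⁻ z, ∫⁻ w, f (u, a, z, w) ∂(κW (z, u)) ∂(κZ a) ∂(κA u) ∂μ := by
  have m1 := fd_m1 (𝒜 := 𝒜) κW
  have m2 : Measurable fun p : 𝒰 × 𝒜 => (κZ p.2).bind fun z =>
      (κW (z, p.1)).map fun w => (p.1, p.2, z, w) := by
    have := fd_meas_bind (κZ.comap (fun p : 𝒰 × 𝒜 => p.2) measurable_snd) _ m1
    simpa only [Kernel.comap_apply] using this
  have m3 : Measurable fun u : 𝒰 => (κA u).bind fun a => (κZ a).bind fun z =>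
      (κW (z, u)).map fun w => (u, a, z, w) := by
    have := fd_meas_bind κA _ m2
    simpa only using this
  have m2' : ∀ u : 𝒰, Measurable fun a : 𝒜 => (κZ a).bind fun z =>
      (κW (z, u)).map fun w => (u, a, z, w) := by
    intro u
    have := m2.comp (measurable_prodMk_left (x := u))
    simpa only [Function.comp_def] using this
  have m1' : ∀ (u : 𝒰) (a : 𝒜), Measurable fun z : 𝒵 =>
      (κW (z, u)).map fun w => (u, a, z, w) := by
    intro u a
    have := m1.comp (measurable_prodMk_left (x := (u, a)))
    simpa only [Function.comp_def] using this
  rw [Measure.lintegral_bind m3.aemeasurable hf.aemeasurable]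
  refine lintegral_congr fun u => ?_
  rw [Measure.lintegral_bind (m2' u).aemeasurable hf.aemeasurable]
  refine lintegral_congr fun a => ?_
  rw [Measure.lintegral_bind (m1' u a).aemeasurable hf.aemeasurable]
  refine lintegral_congr fun z => ?_
  rw [lintegral_map hf (by fun_prop)]

/-- Front-door identification in the collapsed `confounder & interference` model: with hidden
confounder `U ~ μ`, treatment `A | U ~ κA(U)`, mediator `Z | A ~ κZ(A)` (depending only on `A`),
and outcome `W | (Z, U) ~ κW(Z, U)` (depending only on `Z` and `U`), intervene by replacing
`κA` with the constant kernel `δ_{a⋆}`. Under the positivity condition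
`P_A ⊗ κZ(a⋆) ≪ P_{(A,Z)}`, the post-intervention law of `W` is given by the front-door
formula in terms of the observational law `P` of `(U, A, Z, W)` and an observational regular
conditional distribution of `W` given `(A, Z)`. -/
theorem frontdoor_identification
    {𝒰 𝒜 𝒵 𝒲 : Type*}
    [MeasurableSpace 𝒰] [StandardBorelSpace 𝒰]
    [MeasurableSpace 𝒜] [StandardBorelSpace 𝒜]
    [MeasurableSpace 𝒵] [StandardBorelSpace 𝒵]
    [MeasurableSpace 𝒲] [StandardBorelSpace 𝒲] [Nonempty 𝒲]
    (μ : Measure 𝒰) [IsProbabilityMeasure μ]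
    (κA : Kernel 𝒰 𝒜) [IsMarkovKernel κA]
    (κZ : Kernel 𝒜 𝒵) [IsMarkovKernel κZ]
    (κW : Kernel (𝒵 × 𝒰) 𝒲) [IsMarkovKernel κW]
    (astar : 𝒜)
    (P Pstar : Measure (𝒰 × 𝒜 × 𝒵 × 𝒲)) [IsFiniteMeasure P]
    (hP : P = μ.bind fun u => (κA u).bind fun a => (κZ a).bind fun z =>
      (κW (z, u)).map fun w => (u, a, z, w))
    (hPstar : Pstar = μ.bind fun u => (Measure.dirac astar).bind fun a =>
      (κZ a).bind fun z => (κW (z, u)).map fun w => (u, a, z, w))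
    (hpos : (P.map fun v => v.2.1).prod (κZ astar) ≪ P.map fun v => (v.2.1, v.2.2.1)) :
    ∀ S : Set 𝒲, MeasurableSet S →
      (Pstar.map fun v => v.2.2.2) S
        = ∫⁻ z, ∫⁻ a,
            condDistrib (fun v : 𝒰 × 𝒜 × 𝒵 × 𝒲 => v.2.2.2) (fun v => (v.2.1, v.2.2.1)) P
              (a, z) S
            ∂(P.map fun v => v.2.1) ∂(κZ astar) := by
  intro S hS
  have hL := fd_lintegral μ κA κZ κW
  rw [← hP] at hL
  have hLs := fd_lintegral μ (Kernel.const 𝒰 (Measure.dirac astar)) κZ κW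
  simp only [Kernel.const_apply] at hLs
  rw [← hPstar] at hLs
  have : Nonempty 𝒰 := μ.nonempty_of_neZero
  set PA : Measure 𝒜 := P.map fun v => v.2.1 with hPA
  -- disintegration of the law of `(A, U)`
  obtain ⟨η, hηM, hη⟩ : ∃ η : Kernel 𝒜 𝒰, IsMarkovKernel η ∧
      ∀ f : 𝒰 × 𝒜 → ℝ≥0∞, Measurable f →
        ∫⁻ u, ∫⁻ a, f (u, a) ∂(κA u) ∂μ = ∫⁻ a, ∫⁻ u, f (u, a) ∂(η a) ∂PA := by
    set ν : Measure (𝒜 × 𝒰) := (μ ⊗ₘ κA).map Prod.swap with hν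
    have : IsProbabilityMeasure ν := Measure.isProbabilityMeasure_map (by fun_prop)
    have hfst : ν.fst = PA := by
      refine Measure.ext_of_lintegral _ fun f hf => ?_
      rw [hPA, lintegral_map hf (by fun_prop), hL _ (by fun_prop), Measure.fst,
        lintegral_map hf (by fun_prop), hν, lintegral_map (by fun_prop) (by fun_prop),
        Measure.lintegral_compProd (by fun_prop)]
      simp
    refine ⟨ν.condKernel, inferInstance, fun f hf => ?_⟩
    have h1 : ∫⁻ p, f p.swap ∂ν = ∫⁻ u, ∫⁻ a, f (u, a) ∂(κA u) ∂μ := by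
      rw [hν, lintegral_map (by fun_prop) (by fun_prop)]
      simp only [Prod.swap_swap]
      exact Measure.lintegral_compProd hf
    rw [← h1, ← hfst]
    conv_lhs => rw [← ν.disintegrate ν.condKernel]
    rw [Measure.lintegral_compProd (by fun_prop)]
    rfl
  -- the candidate conditional distribution
  let T : Kernel ((𝒜 × 𝒵) × 𝒰) 𝒲 := κW.comap (fun q => (q.1.2, q.2)) (by fun_prop)
  let ηA : Kernel (𝒜 × 𝒵) 𝒰 := η.comap Prod.fst measurable_fst
  let g : Kernel (𝒜 × 𝒵) 𝒲 := (ηA ⊗ₖ T).snd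
  have hg : ∀ (f : 𝒲 → ℝ≥0∞), Measurable f → ∀ a z,
      ∫⁻ w, f w ∂(g (a, z)) = ∫⁻ u, ∫⁻ w, f w ∂(κW (z, u)) ∂(η a) := by
    intro f hf a z
    rw [Kernel.snd_apply, lintegral_map hf (by fun_prop),
      Kernel.lintegral_compProd _ _ _ (by fun_prop)]
    rfl
  have hcond : condDistrib (fun v : 𝒰 × 𝒜 × 𝒵 × 𝒲 => v.2.2.2) (fun v => (v.2.1, v.2.2.1)) P
      =ᵐ[P.map fun v => (v.2.1, v.2.2.1)] g := by
    refine condDistrib_ae_eq_of_measure_eq_compProd _ (by fun_prop) ?_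
    refine Measure.ext_of_lintegral _ fun f hf => ?_
    have mK : Measurable fun p : 𝒜 × 𝒵 => ∫⁻ w, f (p, w) ∂(g p) :=
      hf.lintegral_kernel_prod_right'
    have mW : Measurable fun q : (𝒰 × 𝒜) × 𝒵 =>
        ∫⁻ w, f ((q.1.2, q.2), w) ∂(κW (q.2, q.1.1)) :=
      Measurable.lintegral_kernel_prod_right'
        (κ := κW.comap (fun q : (𝒰 × 𝒜) × 𝒵 => (q.2, q.1.1)) (by fun_prop))
        (f := fun r : ((𝒰 × 𝒜) × 𝒵) × 𝒲 => f ((r.1.1.2, r.1.2), r.2)) (by fun_prop)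
    have mZ : Measurable fun q : 𝒰 × 𝒜 =>
        ∫⁻ z, ∫⁻ w, f ((q.2, z), w) ∂(κW (z, q.1)) ∂(κZ q.2) :=
      Measurable.lintegral_kernel_prod_right'
        (κ := κZ.comap (fun q : 𝒰 × 𝒜 => q.2) (by fun_prop)) mW
    have mH : Measurable fun a : 𝒜 => ∫⁻ z, ∫⁻ w, f ((a, z), w) ∂(g (a, z)) ∂(κZ a) :=
      mK.lintegral_kernel_prod_right'
    rw [lintegral_map hf (by fun_prop), hL _ (by fun_prop),
      Measure.lintegral_compProd hf, lintegral_map mK (by fun_prop),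
      hL (fun v => ∫⁻ w, f ((v.2.1, v.2.2.1), w) ∂(g (v.2.1, v.2.2.1)))
        (mK.comp (g := fun p : 𝒜 × 𝒵 => ∫⁻ w, f (p, w) ∂(g p))
          (f := fun v : 𝒰 × 𝒜 × 𝒵 × 𝒲 => (v.2.1, v.2.2.1)) (by fun_prop))]
    simp only [lintegral_const, measure_univ, mul_one]
    rw [hη (fun q => ∫⁻ z, ∫⁻ w, f ((q.2, z), w) ∂(κW (z, q.1)) ∂(κZ q.2)) mZ,
      hη (fun q => ∫⁻ z, ∫⁻ w, f ((q.2, z), w) ∂(g (q.2, z)) ∂(κZ q.2))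
        (mH.comp measurable_snd)]
    simp only [lintegral_const, measure_univ, mul_one]
    refine lintegral_congr fun a => ?_
    rw [lintegral_lintegral_swap]
    · refine lintegral_congr fun z => ?_
      exact (hg (fun w => f ((a, z), w)) (by fun_prop) a z).symm
    · exact (mW.comp (f := fun q : 𝒰 × 𝒵 => ((q.1, a), q.2)) (by fun_prop)).aemeasurable
  have mWS : Measurable fun q : 𝒵 × 𝒰 => κW q S := κW.measurable_coe hS
  have hgS : ∀ a z, g (a, z) S = ∫⁻ u, κW (z, u) S ∂(η a) := by
    intro a z
    have := hg (S.indicator 1) (measurable_one.indicator hS) a z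
    simpa [lintegral_indicator_one hS] using this
  have hae := hpos.ae_le hcond
  have mC : Measurable fun p : 𝒜 × 𝒵 =>
      condDistrib (fun v : 𝒰 × 𝒜 × 𝒵 × 𝒲 => v.2.2.2) (fun v => (v.2.1, v.2.2.1)) P p S :=
    Kernel.measurable_coe _ hS
  have mg : Measurable fun p : 𝒜 × 𝒵 => g p S := Kernel.measurable_coe _ hS
  have : IsFiniteMeasure PA := by rw [hPA]; infer_instance
  have hR : ∫⁻ z, ∫⁻ a,
      condDistrib (fun v : 𝒰 × 𝒜 × 𝒵 × 𝒲 => v.2.2.2) (fun v => (v.2.1, v.2.2.1)) P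
        (a, z) S ∂PA ∂(κZ astar) = ∫⁻ z, ∫⁻ a, g (a, z) S ∂PA ∂(κZ astar) := by
    rw [← lintegral_prod_symm' _ mC, ← lintegral_prod_symm' _ mg]
    refine lintegral_congr_ae ?_
    filter_upwards [hae] with p hp
    rw [hp]
  rw [hR]
  have hRz : ∀ z, ∫⁻ a, g (a, z) S ∂PA = ∫⁻ u, κW (z, u) S ∂μ := by
    intro z
    simp_rw [hgS]
    rw [← hη (fun q => κW (z, q.1) S) (mWS.comp (by fun_prop))]
    simp
  simp_rw [hRz]
  rw [← lintegral_indicator_one hS,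
    lintegral_map (measurable_one.indicator hS) (by fun_prop),
    hLs (fun v => S.indicator 1 v.2.2.2) ((measurable_one.indicator hS).comp (by fun_prop))]
  simp only [lintegral_indicator_one hS]
  have : ∀ u, ∫⁻ a, ∫⁻ z, κW (z, u) S ∂(κZ a) ∂(Measure.dirac astar)
      = ∫⁻ z, κW (z, u) S ∂(κZ astar) := fun u =>
    lintegral_dirac' _ (Measurable.lintegral_kernel (mWS.comp measurable_prodMk_right))
  simp_rw [this]
  rw [lintegral_lintegral_swap]
  exact (mWS.comp measurable_swap).aemeasurable
end

section
/- Let 𝒰, 𝒳, 𝒯, 𝒴 be standard Borel spaces, μ a probability measure on 𝒰, and κ_X : 𝒰 → 𝒳, κ_T : 𝒳 → 𝒯, κ_Y : 𝒯 × 𝒰 → 𝒴 Markov kernels. Define the observational joint law P of (U, X, T, Y) by U ~ μ, X | U = u ~ κ_X(u), T | (U, X) = (u, x) ~ κ_T(x) (T depends only on X), and Y | (U, X, T) = (u, x, t) ~ κ_Y(t, u) (Y depends only on T and U). Fix t⋆ ∈ 𝒯 and define the post-intervention law P_⋆ by replacing κ_T with the constant kernel x ↦ δ_{t⋆}. Let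 P_X and P_{(T,X)} denote the observational laws of X and of (T, X), and assume the positivity condition δ_{t⋆} ⊗ P_X ≪ P_{(T,X)}. Then the post-intervention law of Y is given by the backdoor adjustment formula: for every measurable S ⊆ 𝒴, P_⋆(Y ∈ S) = ∫_𝒳 condDistrib(Y | (T,X))((t⋆, x), S) dP_X(x), where condDistrib(Y | (T,X)) is an observational regular conditional distribution of Y given (T, X). -/
open MeasureTheory ProbabilityTheory
open scoped ENNReal

section Helpers

variable {A B C : Type*} [MeasurableSpace A] [MeasurableSpace B] [MeasurableSpace C]

lemma measurable_bind_kernel (κ : Kernel A B) [IsSFiniteKernel κ] (g : A → B → Measure C)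
    (hg : Measurable fun p : A × B => g p.1 p.2) :
    Measurable fun a => (κ a).bind (g a) := by
  refine Measure.measurable_of_measurable_coe _ fun s hs => ?_
  have h : ∀ a, (κ a).bind (g a) s = ∫⁻ b, g a b s ∂(κ a) := fun a =>
    Measure.bind_apply hs (hg.comp measurable_prodMk_left).aemeasurable
  simp_rw [h]
  exact Measurable.lintegral_kernel_prod_right
    (f := fun a b => g a b s) ((Measure.measurable_coe hs).comp hg)

lemma measurable_map_kernel (κ : Kernel A B) [IsSFiniteKernel κ] (g : A → B → C)
    (hg : Measurable fun p : A × B => g p.1 p.2) :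
    Measurable fun a => (κ a).map (g a) := by
  refine Measure.measurable_of_measurable_coe _ fun s hs => ?_
  have h : ∀ a, (κ a).map (g a) s = κ a (Prod.mk a ⁻¹' ((fun p : A × B => g p.1 p.2) ⁻¹' s)) :=
    fun a => Measure.map_apply (hg.comp measurable_prodMk_left) hs
  simp_rw [h]
  exact Kernel.measurable_kernel_prodMk_left (hg hs)

lemma measurable_bind_comap {D : Type*} [MeasurableSpace D] (κ : Kernel D B) [IsSFiniteKernel κ]
    (h : A → D) (hh : Measurable h) (g : A → B → Measure C)
    (hg : Measurable fun p : A × B => g p.1 p.2) :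
    Measurable fun a => (κ (h a)).bind (g a) := by
  have := measurable_bind_kernel (κ.comap h hh) g hg
  simpa only [Kernel.comap_apply] using this

lemma measurable_map_comap {D : Type*} [MeasurableSpace D] (κ : Kernel D B) [IsSFiniteKernel κ]
    (h : A → D) (hh : Measurable h) (g : A → B → C)
    (hg : Measurable fun p : A × B => g p.1 p.2) :
    Measurable fun a => (κ (h a)).map (g a) := by
  have := measurable_map_kernel (κ.comap h hh) g hg
  simpa only [Kernel.comap_apply] using this

end Helpers

lemma lintegral_model
    {𝒰 𝒳 𝒯 𝒴 : Type*}
    [MeasurableSpace 𝒰] [MeasurableSpace 𝒳] [MeasurableSpace 𝒯] [MeasurableSpace 𝒴]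
    (μ : Measure 𝒰)
    (κX : Kernel 𝒰 𝒳) [IsMarkovKernel κX]
    (κT : Kernel 𝒳 𝒯) [IsMarkovKernel κT]
    (κY : Kernel (𝒯 × 𝒰) 𝒴) [IsMarkovKernel κY]
    (f : 𝒰 × 𝒳 × 𝒯 × 𝒴 → ℝ≥0∞) (hf : Measurable f) :
    ∫⁻ v, f v ∂(μ.bind fun u => (κX u).bind fun x => (κT x).bind fun t =>
      (κY (t, u)).map fun y => (u, x, t, y))
    = ∫⁻ u, ∫⁻ x, ∫⁻ t, ∫⁻ y, f (u, x, t, y) ∂(κY (t, u)) ∂(κT x) ∂(κX u) ∂μ := by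
  have m1 : ∀ (u : 𝒰) (x : 𝒳), Measurable fun t => (κY (t, u)).map fun y => (u, x, t, y) := fun u x =>
    measurable_map_comap κY (fun t : 𝒯 => (t, u)) (by fun_prop)
      (fun t y => (u, x, t, y)) (by fun_prop)
  have m1' : Measurable fun p : (𝒰 × 𝒳) × 𝒯 =>
      (κY (p.2, p.1.1)).map fun y => (p.1.1, p.1.2, p.2, y) :=
    measurable_map_comap κY (fun p : (𝒰 × 𝒳) × 𝒯 => (p.2, p.1.1)) (by fun_prop)
      (fun p y => (p.1.1, p.1.2, p.2, y)) (by fun_prop)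
  generalize hg : (fun (u : 𝒰) (x : 𝒳) (t : 𝒯) =>
    (κY (t, u)).map fun y => (u, x, t, y)) = g at *
  have e : ∀ u x t, (κY (t, u)).map (fun y => (u, x, t, y)) = g u x t := fun u x t => by rw [← hg]
  have e2 : ∀ u x t, ∫⁻ y, f (u, x, t, y) ∂(κY (t, u)) = ∫⁻ v, f v ∂(g u x t) := fun u x t => by
    rw [← e, lintegral_map hf (by fun_prop)]
  simp only [e] at m1 m1'
  simp only [e, e2]
  clear e e2 hg
  have m2' : Measurable fun p : 𝒰 × 𝒳 => (κT p.2).bind (g p.1 p.2) :=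
    measurable_bind_comap κT (fun p : 𝒰 × 𝒳 => p.2) measurable_snd
      (fun p t => g p.1 p.2 t) m1'
  have m2 : ∀ u, Measurable fun x => (κT x).bind (g u x) := by
    intro u
    have hu : Measurable fun p : 𝒳 × 𝒯 => ((u, p.1), p.2) := by fun_prop
    have hm : Measurable fun p : 𝒳 × 𝒯 => g u p.1 p.2 := m1'.comp hu
    exact measurable_bind_kernel κT (g u) hm
  have m3 : Measurable fun u : 𝒰 => (κX u).bind fun x => (κT x).bind (g u x) :=
    measurable_bind_kernel κX (fun u x => (κT x).bind (g u x)) m2'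
  rw [Measure.lintegral_bind m3.aemeasurable hf.aemeasurable]
  refine lintegral_congr fun u => ?_
  rw [Measure.lintegral_bind (m2 u).aemeasurable hf.aemeasurable]
  refine lintegral_congr fun x => ?_
  rw [Measure.lintegral_bind (m1 u x).aemeasurable hf.aemeasurable]

/-- Backdoor identification in the marginalized `instrument` model: with hidden confounder
`U ~ μ`, covariate `X | U ~ κX(U)`, treatment `T | X ~ κT(X)` (depending only on `X`), and
outcome `Y | (T, U) ~ κY(T, U)` (depending only on `T` and `U`), intervene by replacing `κT`
with the constant kernel `δ_{t⋆}`. Under the positivity condition `δ_{t⋆} ⊗ P_X ≪ P_{(T,X)}`,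
the post-intervention law of `Y` is given by the backdoor adjustment formula in terms of the
observational law `P` of `(U, X, T, Y)` and an observational regular conditional distribution
of `Y` given `(T, X)`. -/
theorem backdoor_identification
    {𝒰 𝒳 𝒯 𝒴 : Type*}
    [MeasurableSpace 𝒰] [StandardBorelSpace 𝒰]
    [MeasurableSpace 𝒳] [StandardBorelSpace 𝒳]
    [MeasurableSpace 𝒯] [StandardBorelSpace 𝒯]
    [MeasurableSpace 𝒴] [StandardBorelSpace 𝒴] [Nonempty 𝒴]
    (μ : Measure 𝒰) [IsProbabilityMeasure μ]
    (κX : Kernel 𝒰 𝒳) [IsMarkovKernel κX]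
    (κT : Kernel 𝒳 𝒯) [IsMarkovKernel κT]
    (κY : Kernel (𝒯 × 𝒰) 𝒴) [IsMarkovKernel κY]
    (tstar : 𝒯)
    (P Pstar : Measure (𝒰 × 𝒳 × 𝒯 × 𝒴)) [IsFiniteMeasure P]
    (hP : P = μ.bind fun u => (κX u).bind fun x => (κT x).bind fun t =>
      (κY (t, u)).map fun y => (u, x, t, y))
    (hPstar : Pstar = μ.bind fun u => (κX u).bind fun x => (Measure.dirac tstar).bind fun t =>
      (κY (t, u)).map fun y => (u, x, t, y))
    (hpos : (Measure.dirac tstar).prod (P.map fun v => v.2.1)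
      ≪ P.map fun v => (v.2.2.1, v.2.1)) :
    ∀ S : Set 𝒴, MeasurableSet S →
      (Pstar.map fun v => v.2.2.2) S
        = ∫⁻ x,
            condDistrib (fun v : 𝒰 × 𝒳 × 𝒯 × 𝒴 => v.2.2.2) (fun v => (v.2.2.1, v.2.1)) P
              (tstar, x) S
            ∂(P.map fun v => v.2.1) := by
  intro S hS
  have : Nonempty 𝒰 := μ.nonempty_of_neZero
  have swapF : ∀ f : 𝒳 × 𝒰 → ℝ≥0∞, Measurable f →
      ∫⁻ u, ∫⁻ x, f (x, u) ∂(κX u) ∂μ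
        = ∫⁻ x, ∫⁻ u, f (x, u) ∂((κX†μ) x) ∂(κX ∘ₘ μ) := by
    intro f hf
    rw [← Measure.lintegral_compProd hf, compProd_posterior_eq_map_swap,
      lintegral_map hf measurable_swap,
      Measure.lintegral_compProd (f := fun a : 𝒰 × 𝒳 => f a.swap) (hf.comp measurable_swap)]
    rfl
  have mη : Measurable fun p : 𝒯 × 𝒳 => ((κX†μ) p.2).bind fun u => κY (p.1, u) :=
    measurable_bind_kernel ((κX†μ).comap (fun p : 𝒯 × 𝒳 => p.2) measurable_snd)
      (fun p u => κY (p.1, u)) (κY.measurable.comp (by fun_prop))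
  let η : Kernel (𝒯 × 𝒳) 𝒴 := ⟨_, mη⟩
  have hη : ∀ (t : 𝒯) (x : 𝒳) (g : 𝒴 → ℝ≥0∞), Measurable g →
      ∫⁻ y, g y ∂(η (t, x)) = ∫⁻ u, ∫⁻ y, g y ∂(κY (t, u)) ∂((κX†μ) x) := by
    intro t x g hg
    have m : Measurable fun u => κY (t, u) := κY.measurable.comp measurable_prodMk_left
    exact Measure.lintegral_bind m.aemeasurable hg.aemeasurable
  have : IsMarkovKernel η := by
    refine ⟨fun p => ⟨?_⟩⟩
    have h := hη p.1 p.2 (fun _ => 1) measurable_const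
    simpa using h
  have LP : ∀ f : 𝒰 × 𝒳 × 𝒯 × 𝒴 → ℝ≥0∞, Measurable f → ∫⁻ v, f v ∂P
      = ∫⁻ u, ∫⁻ x, ∫⁻ t, ∫⁻ y, f (u, x, t, y) ∂(κY (t, u)) ∂(κT x) ∂(κX u) ∂μ := by
    intro f hf
    rw [hP]
    exact lintegral_model μ κX κT κY f hf
  have hPX : P.map (fun v => v.2.1) = κX ∘ₘ μ := by
    refine Measure.ext_of_lintegral _ fun f hf => ?_
    rw [lintegral_map hf (by fun_prop), LP _ (by fun_prop),
      Measure.lintegral_bind κX.measurable.aemeasurable hf.aemeasurable]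
    simp
  have hcond : condDistrib (fun v : 𝒰 × 𝒳 × 𝒯 × 𝒴 => v.2.2.2) (fun v => (v.2.2.1, v.2.1)) P
      =ᵐ[P.map fun v => (v.2.2.1, v.2.1)] η := by
    refine condDistrib_ae_eq_of_measure_eq_compProd _ (by fun_prop) ?_
    refine Measure.ext_of_lintegral _ fun f hf => ?_
    have mG : Measurable fun p : 𝒯 × 𝒳 => ∫⁻ y, f (p, y) ∂(η p) :=
      hf.lintegral_kernel_prod_right'
    have mpr : Measurable fun v : 𝒰 × 𝒳 × 𝒯 × 𝒴 => (v.2.2.1, v.2.1) := by fun_prop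
    rw [lintegral_map hf (by fun_prop), LP _ (by fun_prop), Measure.lintegral_compProd hf,
      lintegral_map mG mpr]
    refine Eq.trans ?_ (LP _ (mG.comp mpr)).symm
    simp only [Function.comp_apply]
    simp only [lintegral_const, measure_univ, mul_one]
    have mI : Measurable fun q : (𝒳 × 𝒰) × 𝒯 => ∫⁻ y, f ((q.2, q.1.1), y) ∂(κY (q.2, q.1.2)) :=
      Measurable.lintegral_kernel_prod_right'
        (κ := κY.comap (fun q : (𝒳 × 𝒰) × 𝒯 => (q.2, q.1.2)) (by fun_prop))
        (f := fun r : ((𝒳 × 𝒰) × 𝒯) × 𝒴 => f ((r.1.2, r.1.1.1), r.2)) (by fun_prop)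
    have mJ : Measurable fun q : 𝒳 × 𝒰 =>
        ∫⁻ t, ∫⁻ y, f ((t, q.1), y) ∂(κY (t, q.2)) ∂(κT q.1) :=
      Measurable.lintegral_kernel_prod_right'
        (κ := κT.comap (fun q : 𝒳 × 𝒰 => q.1) measurable_fst) mI
    have mK : Measurable fun x : 𝒳 => ∫⁻ t, ∫⁻ y, f ((t, x), y) ∂(η (t, x)) ∂(κT x) :=
      Measurable.lintegral_kernel_prod_right' (κ := κT)
        (f := fun q : 𝒳 × 𝒯 => ∫⁻ y, f ((q.2, q.1), y) ∂(η (q.2, q.1)))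
        (mG.comp measurable_swap)
    rw [swapF _ mJ, ← Measure.lintegral_bind κX.measurable.aemeasurable mK.aemeasurable]
    refine lintegral_congr fun x => ?_
    have e : ∀ t, ∫⁻ y, f ((t, x), y) ∂(η (t, x))
        = ∫⁻ u, ∫⁻ y, f ((t, x), y) ∂(κY (t, u)) ∂((κX†μ) x) :=
      fun t => hη t x _ (by fun_prop)
    simp_rw [e]
    refine lintegral_lintegral_swap ?_
    have mr : Measurable fun r : 𝒰 × 𝒯 => ((x, r.1), r.2) := by fun_prop
    exact (mI.comp mr).aemeasurable
  have hae := hpos.ae_le hcond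
  have hae2 : ∀ᵐ x ∂(P.map fun v => v.2.1),
      condDistrib (fun v : 𝒰 × 𝒳 × 𝒯 × 𝒴 => v.2.2.2) (fun v => (v.2.2.1, v.2.1)) P (tstar, x)
        = η (tstar, x) := by
    rw [Measure.dirac_prod] at hae
    exact ae_of_ae_map (by fun_prop) hae
  have m1S : Measurable (S.indicator (1 : 𝒴 → ℝ≥0∞)) := measurable_one.indicator hS
  have hR : ∀ x, η (tstar, x) S = ∫⁻ u, κY (tstar, u) S ∂((κX†μ) x) := by
    intro x
    have h := hη tstar x (S.indicator 1) m1S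
    simpa [lintegral_indicator_one hS] using h
  have mS : Measurable fun u => κY (tstar, u) S :=
    (κY.measurable_coe hS).comp measurable_prodMk_left
  rw [lintegral_congr_ae (g := fun x => ∫⁻ u, κY (tstar, u) S ∂((κX†μ) x))
    (hae2.mono fun x hx => by simp only [hx, hR]), hPX,
    ← swapF (fun q => κY (tstar, q.2) S) (mS.comp measurable_snd)]
  rw [← lintegral_indicator_one hS, lintegral_map m1S (by fun_prop), hPstar]
  have h := lintegral_model μ κX (Kernel.const 𝒳 (Measure.dirac tstar)) κY
    (fun v => S.indicator 1 v.2.2.2) (m1S.comp (by fun_prop))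
  simp only [Kernel.const_apply] at h
  rw [h]
  refine lintegral_congr fun u => lintegral_congr fun x => ?_
  simp only [lintegral_indicator_one hS]
  have mt : Measurable fun t => κY (t, u) S := (κY.measurable_coe hS).comp (by fun_prop)
  rw [lintegral_dirac' _ mt]
end

section
/- Let X, S, Y be measurable spaces, μ a probability measure on X, κ a Markov kernel from X to Y, λ a Markov kernel from X to S, and ρ a Markov kernel from X × S to Y. Define the Markov kernel κ' from X to Y by κ'(x) = (λ(x)).bind(s ↦ ρ(x, s)). Then KL(μ ⊗ κ ‖ μ ⊗ κ') ≤ ∫_X ∫_S KL(κ(x) ‖ ρ(x, s)) dλ(x)(s) dμ(x), where μ ⊗ κ denotes the joint probability measure on X × Y with first marginal μ and conditional κ. -/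
open MeasureTheory ProbabilityTheory
open scoped ENNReal Classical

/-- The divergence of the statement agrees with Mathlib's for probability measures. -/
lemma klDiv_eq_mathlib {α : Type*} [MeasurableSpace α] (μ ν : Measure α)
    [IsProbabilityMeasure μ] [IsProbabilityMeasure ν] :
    klDiv μ ν = InformationTheory.klDiv μ ν := by
  rw [klDiv, InformationTheory.klDiv_def]
  simp [llr_def]

/-- Combine countably many maps into Cantor space into one. -/
lemma factor_combine {Y : Type*} [MeasurableSpace Y] (φ : ℕ → Y → (ℕ → Bool))
    (hφ : ∀ n, Measurable (φ n)) :
    ∃ (ψ : Y → (ℕ → Bool)) (π : ℕ → (ℕ → Bool) → (ℕ → Bool)), Measurable ψ ∧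
      (∀ n, Measurable (π n)) ∧ ∀ n y, π n (ψ y) = φ n y := by
  refine ⟨fun y k => φ k.unpair.1 y k.unpair.2, fun n b j => b (Nat.pair n j), ?_, ?_, ?_⟩
  · refine measurable_pi_lambda _ fun k => ?_
    exact (measurable_pi_apply _).comp (hφ _)
  · intro n
    exact measurable_pi_lambda _ fun j => measurable_pi_apply _
  · intro n y
    simp

/-- A measurable set of a product only depends on countably many measurable sets of the
second factor. -/
lemma factor_set {Z Y : Type*} [MeasurableSpace Z] [MeasurableSpace Y] (E : Set (Z × Y))
    (hE : MeasurableSet E) :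
    ∃ (φ : Y → (ℕ → Bool)) (E' : Set (Z × (ℕ → Bool))), Measurable φ ∧ MeasurableSet E' ∧
      E = Prod.map id φ ⁻¹' E' := by
  rw [← generateFrom_prod] at hE
  induction E, hE using MeasurableSpace.generateFrom_induction with
  | hC t ht _ =>
    obtain ⟨A, hA, B, hB, rfl⟩ := ht
    refine ⟨fun y _ => decide (y ∈ B), A ×ˢ {b | b 0 = true}, ?_, ?_, ?_⟩
    · refine measurable_pi_lambda _ fun _ => ?_
      refine measurable_to_bool ?_
      have hB' : MeasurableSet B := hB
      have : (fun y => decide (y ∈ B)) ⁻¹' {true} = B := by ext y; simp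
      rw [this]
      exact hB'
    · exact MeasurableSet.prod hA
        (measurableSet_eq_fun (measurable_pi_apply 0) measurable_const)
    · ext ⟨z, y⟩; simp
  | empty => exact ⟨fun _ _ => true, ∅, measurable_const, MeasurableSet.empty, by simp⟩
  | compl t _ ih =>
    obtain ⟨φ, E', hφ, hE', rfl⟩ := ih
    exact ⟨φ, E'ᶜ, hφ, hE'.compl, rfl⟩
  | iUnion s _ ih =>
    choose φ E' hφ hE' h using ih
    obtain ⟨ψ, π, hψ, hπ, hc⟩ := factor_combine φ hφ
    refine ⟨ψ, ⋃ n, Prod.map id (π n) ⁻¹' E' n, hψ,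
      MeasurableSet.iUnion fun n => (measurable_id.prodMap (hπ n)) (hE' n), ?_⟩
    ext ⟨z, y⟩
    simp [h, hc]

/-- A measurable function on a product only depends on countably many measurable sets of the
second factor. -/
lemma factor_fun {Z Y : Type*} [MeasurableSpace Z] [MeasurableSpace Y] (f : Z × Y → ℝ≥0∞)
    (hf : Measurable f) :
    ∃ (φ : Y → (ℕ → Bool)) (f' : Z × (ℕ → Bool) → ℝ≥0∞), Measurable φ ∧ Measurable f' ∧
      f = f' ∘ Prod.map id φ := by
  choose φ E' hφ hE' h using fun n => factor_set
    (f ⁻¹' (MeasurableSpace.natGeneratingSequence ℝ≥0∞ n))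
    (hf (MeasurableSpace.measurableSet_natGeneratingSequence n))
  obtain ⟨ψ, π, hψ, hπ, hc⟩ := factor_combine φ hφ
  have key : Measurable[MeasurableSpace.comap (Prod.map (id : Z → Z) ψ) inferInstance] f := by
    have hg := MeasurableSpace.generateFrom_natGeneratingSequence ℝ≥0∞
    rw [← hg]
    refine @measurable_generateFrom _ _ (MeasurableSpace.comap _ _) _ _ ?_
    rintro _ ⟨n, rfl⟩
    refine ⟨Prod.map id (π n) ⁻¹' E' n, (measurable_id.prodMap (hπ n)) (hE' n), ?_⟩
    rw [h]
    ext ⟨z, y⟩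
    simp [hc]
  obtain ⟨f', hf', h'⟩ := key.exists_eq_measurable_comp
  exact ⟨ψ, f', hψ, hf', h'⟩

/-- Chain-rule upper bound on arbitrary measurable spaces, with a measurable minorant of the
pointwise divergence. -/
lemma exists_minorant {Z Y : Type*} [MeasurableSpace Z] [MeasurableSpace Y]
    (P : Measure Z) [IsProbabilityMeasure P] (κ ρ : Kernel Z Y)
    [IsMarkovKernel κ] [IsMarkovKernel ρ] :
    ∃ g : Z → ℝ≥0∞, Measurable g ∧
      (∀ᵐ z ∂P, g z ≤ InformationTheory.klDiv (κ z) (ρ z)) ∧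
      InformationTheory.klDiv (P.compProd κ) (P.compProd ρ) ≤ ∫⁻ z, g z ∂P := by
  by_cases hac : P.compProd κ ≪ P.compProd ρ
  · obtain ⟨φ, d', hφ, hd', hd⟩ := factor_fun ((P.compProd κ).rnDeriv (P.compProd ρ))
      (Measure.measurable_rnDeriv _ _)
    have : IsMarkovKernel (κ.map φ) := Kernel.IsMarkovKernel.map _ hφ
    have : IsMarkovKernel (ρ.map φ) := Kernel.IsMarkovKernel.map _ hφ
    have hφ2 : Measurable (Prod.map (id : Z → Z) φ) := measurable_id.prodMap hφ
    have hac' : P.compProd (κ.map φ) ≪ P.compProd (ρ.map φ) := by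
      rw [Measure.compProd_map hφ, Measure.compProd_map hφ]
      exact hac.map hφ2
    have hack : ∀ᵐ z ∂P, κ.map φ z ≪ ρ.map φ z := hac'.kernel_of_compProd
    set r := Kernel.rnDeriv (κ.map φ) (ρ.map φ) with hr
    have hrm : Measurable (Function.uncurry r) := Kernel.measurable_rnDeriv _ _
    have h1 : P.compProd (κ.map φ) = (P.compProd (ρ.map φ)).withDensity d' := by
      rw [Measure.compProd_map hφ, Measure.compProd_map hφ]
      ext s hs
      rw [Measure.map_apply hφ2 hs, withDensity_apply _ hs, setLIntegral_map hs hd' hφ2,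
        ← Measure.setLIntegral_rnDeriv hac, hd]
      rfl
    have h2 : P.compProd (κ.map φ) =
        (P.compProd (ρ.map φ)).withDensity (Function.uncurry r) := by
      have hk : κ.map φ =ᵐ[P] (ρ.map φ).withDensity r := by
        filter_upwards [hack] with z hz
        rw [Kernel.withDensity_rnDeriv_eq hz]
      rw [Measure.compProd_congr hk, Measure.compProd_withDensity hrm]
      rfl
    have hdr : d' =ᵐ[P.compProd (ρ.map φ)] Function.uncurry r := by
      have e1 := Measure.rnDeriv_withDensity (P.compProd (ρ.map φ)) hd'
      have e2 := Measure.rnDeriv_withDensity (P.compProd (ρ.map φ)) hrm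
      rw [← h1] at e1
      rw [← h2] at e2
      exact e1.symm.trans e2
    have hkl : Measurable fun x : ℝ≥0∞ =>
        ENNReal.ofReal (InformationTheory.klFun x.toReal) := by fun_prop
    refine ⟨fun z => ∫⁻ y, ENNReal.ofReal (InformationTheory.klFun (r z y).toReal)
      ∂(ρ.map φ z), ?_, ?_, ?_⟩
    · exact Measurable.lintegral_kernel_prod_right (hkl.comp hrm)
    · filter_upwards [hack] with z hz
      refine le_trans (le_of_eq ?_) (InformationTheory.klDiv_map_le (κ z) (ρ z) hφ)
      rw [← Kernel.map_apply _ hφ, ← Kernel.map_apply _ hφ,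
        InformationTheory.klDiv_eq_lintegral_klFun_of_ac hz]
      refine lintegral_congr_ae ?_
      filter_upwards [Kernel.rnDeriv_eq_rnDeriv_measure (κ := κ.map φ) (η := ρ.map φ) (a := z)]
        with y hy
      rw [hr, hy]
    · rw [InformationTheory.klDiv_eq_lintegral_klFun_of_ac hac, hd]
      have := Measure.lintegral_compProd (μ := P) (κ := ρ.map φ) (hkl.comp hrm)
      simp only [Function.comp_def, Function.uncurry_apply_pair] at this
      rw [← this]
      have e3 : ∫⁻ x, ENNReal.ofReal (InformationTheory.klFun (Function.uncurry r x).toReal)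
          ∂(P.compProd (ρ.map φ)) = ∫⁻ x, ENNReal.ofReal (InformationTheory.klFun (d' x).toReal)
          ∂(P.compProd (ρ.map φ)) := by
        refine lintegral_congr_ae ?_
        filter_upwards [hdr] with x hx
        rw [hx]
      rw [e3, Measure.compProd_map hφ]
      exact (lintegral_map (μ := P.compProd ρ) (hkl.comp hd') hφ2).ge
  · have : ∃ E, MeasurableSet E ∧ P.compProd ρ E = 0 ∧ P.compProd κ E ≠ 0 := by
      by_contra! hcon
      exact hac (Measure.AbsolutelyContinuous.mk fun s hs h0 => hcon s hs h0)
    obtain ⟨E, hE, hE0, hE1⟩ := this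
    obtain ⟨φ, E', hφ, hE', rfl⟩ := factor_set E hE
    have : IsMarkovKernel (κ.map φ) := Kernel.IsMarkovKernel.map _ hφ
    have : IsMarkovKernel (ρ.map φ) := Kernel.IsMarkovKernel.map _ hφ
    have hφ2 : Measurable (Prod.map (id : Z → Z) φ) := measurable_id.prodMap hφ
    have hnac : ¬ ∀ᵐ z ∂P, κ.map φ z ≪ ρ.map φ z := by
      intro h
      have h' := Measure.AbsolutelyContinuous.compProd_right h
      rw [Measure.compProd_map hφ, Measure.compProd_map hφ] at h'
      refine hE1 ?_
      rw [← Measure.map_apply hφ2 hE']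
      apply h'
      rwa [Measure.map_apply hφ2 hE']
    have hA : MeasurableSet {z | κ.map φ z ≪ ρ.map φ z} :=
      Kernel.measurableSet_absolutelyContinuous _ _
    refine ⟨{z | κ.map φ z ≪ ρ.map φ z}ᶜ.indicator fun _ => ⊤,
      measurable_const.indicator hA.compl, ?_, ?_⟩
    · refine Filter.Eventually.of_forall fun z => ?_
      refine le_trans ?_ (InformationTheory.klDiv_map_le (κ z) (ρ z) hφ)
      rw [← Kernel.map_apply _ hφ, ← Kernel.map_apply _ hφ]
      by_cases hz : κ.map φ z ≪ ρ.map φ z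
      · simp [Set.indicator, hz]
      · simp [InformationTheory.klDiv_of_not_ac hz]
    · rw [lintegral_indicator hA.compl, setLIntegral_const, ENNReal.top_mul]
      · exact le_top
      · exact hnac

theorem klDiv_compProd_le_of_mixture
    {X S Y : Type*} [MeasurableSpace X] [MeasurableSpace S] [MeasurableSpace Y]
    (μ : Measure X) [IsProbabilityMeasure μ]
    (κ : Kernel X Y) [IsMarkovKernel κ]
    (lam : Kernel X S) [IsMarkovKernel lam]
    (ρ : Kernel (X × S) Y) [IsMarkovKernel ρ]
    (κ' : Kernel X Y) [IsMarkovKernel κ']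
    (hκ' : ∀ x, κ' x = (lam x).bind fun s => ρ (x, s)) :
    klDiv (μ.compProd κ) (μ.compProd κ')
      ≤ ∫⁻ x, ∫⁻ s, klDiv (κ x) (ρ (x, s)) ∂(lam x) ∂μ := by
  simp_rw [klDiv_eq_mathlib]
  obtain ⟨g, hg, hle, hint⟩ := exists_minorant (μ.compProd lam)
    (κ.comap Prod.fst measurable_fst) ρ
  have hp : Measurable fun p : (X × S) × Y => (p.1.1, p.2) := by fun_prop
  have m1 : ((μ.compProd lam).compProd (κ.comap Prod.fst measurable_fst)).map
      (fun p : (X × S) × Y => (p.1.1, p.2)) = μ.compProd κ := by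
    ext s hs
    rw [Measure.map_apply hp hs, Measure.compProd_apply (hp hs), Measure.compProd_apply hs,
      Measure.lintegral_compProd (Kernel.measurable_kernel_prodMk_left (hp hs))]
    refine lintegral_congr fun x => ?_
    simp only [Kernel.comap_apply]
    change ∫⁻ _, κ x (Prod.mk x ⁻¹' s) ∂(lam x) = _
    simp
  have m2 : ((μ.compProd lam).compProd ρ).map
      (fun p : (X × S) × Y => (p.1.1, p.2)) = μ.compProd κ' := by
    ext s hs
    rw [Measure.map_apply hp hs, Measure.compProd_apply (hp hs), Measure.compProd_apply hs,
      Measure.lintegral_compProd (Kernel.measurable_kernel_prodMk_left (hp hs))]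
    refine lintegral_congr fun x => ?_
    rw [hκ']
    have hm : Measurable fun s => ρ (x, s) := ρ.measurable.comp measurable_prodMk_left
    rw [Measure.bind_apply (measurable_prodMk_left hs) hm.aemeasurable]
    rfl
  calc InformationTheory.klDiv (μ.compProd κ) (μ.compProd κ')
      ≤ _ := by rw [← m1, ← m2]; exact InformationTheory.klDiv_map_le _ _ hp
    _ ≤ _ := hint
    _ = ∫⁻ x, ∫⁻ s, g (x, s) ∂(lam x) ∂μ := Measure.lintegral_compProd hg
    _ ≤ _ := by
      refine lintegral_mono_ae ?_
      filter_upwards [Measure.ae_ae_of_ae_compProd hle] with x hx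
      refine lintegral_mono_ae ?_
      filter_upwards [hx] with s hs
      simpa [Kernel.comap_apply] using hs
end
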